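/- arXiv:1012.2214 — 4 statements merged into one kernel-verified Lean document; each statement's English description precedes it below -/
import Mathlib

section
/- Let f ∈ 𝒜. Suppose there exist an analytic function Φ defined on f(𝔻) and an analytic function h on 𝔻 with Re h(z) > 0 for all z ∈ 𝔻, such that z·f'(z) = Φ(f(z))·h(z) for all z ∈ 𝔻 (i.e., f is Φ-like, meaning Re(z f'(z)/Φ(f(z))) > 0 on 𝔻). Then f is univalent (injective) on 𝔻. -/
open Complex Metric Filter Topology

/-- If `f'` is locally a multiple of `Φ ∘ f` by an analytic function and `Φ` vanishes at `f a`,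
then `f` is locally constant at `a`. -/
lemma eventually_eq_of_deriv_eq_comp_mul {f Φ k : ℂ → ℂ} {a : ℂ} (hf : AnalyticAt ℂ f a)
    (hΦ : AnalyticAt ℂ Φ (f a)) (hk : AnalyticAt ℂ k a)
    (heq : ∀ᶠ z in 𝓝 a, deriv f z = Φ (f z) * k z) (h0 : Φ (f a) = 0) :
    ∀ᶠ z in 𝓝 a, f z = f a := by
  have hg : AnalyticAt ℂ (Φ ∘ f) a := hΦ.comp hf
  have hord : analyticOrderAt (deriv f) a =
      analyticOrderAt Φ (f a) * analyticOrderAt (f · - f a) a + analyticOrderAt k a := by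
    rw [← hΦ.analyticOrderAt_comp hf, ← analyticOrderAt_mul hg hk]
    exact analyticOrderAt_congr heq
  have hadd := hf.analyticOrderAt_deriv_add_one
  have hone : 1 ≤ analyticOrderAt Φ (f a) :=
    Order.one_le_iff_pos.2 (pos_iff_ne_zero.2 (hΦ.analyticOrderAt_ne_zero.2 h0))
  have hle : analyticOrderAt (f · - f a) a ≤ analyticOrderAt (deriv f) a := by
    rw [hord]
    exact (le_mul_of_one_le_left zero_le hone).trans le_self_add
  have htop : analyticOrderAt (f · - f a) a = ⊤ := by
    rw [← hadd] at hle
    by_contra hne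
    rw [← hadd] at hne
    generalize analyticOrderAt (deriv f) a = n at hle hne
    cases n with
    | top => simp at hne
    | coe n => norm_cast at hle; omega
  filter_upwards [analyticOrderAt_eq_top.1 htop] with z hz using sub_eq_zero.1 hz

lemma HasDerivAt.eventually_lt_of_neg {u : ℝ → ℝ} {u' x : ℝ} (hu : HasDerivAt u u' x)
    (hneg : u' < 0) : ∀ᶠ t in 𝓝[>] x, u t < u x := by
  have hs := (hasDerivAt_iff_tendsto_slope.1 hu).eventually_lt_const hneg
  filter_upwards [hs.filter_mono (nhdsWithin_mono x fun t (ht : x < t) => ht.ne'),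
    self_mem_nhdsWithin] with t ht hxt
  rw [slope_def_field, div_lt_iff₀ (sub_pos.2 hxt)] at ht
  linarith

/-- Lifting the path `t ↦ f a - t w` through `f` near `a` gives a path starting at `a`, whose norm
initially decreases if `w / f' a = c a` with `0 < c.re`. -/
lemma exists_lift_norm_decreasing {f : ℂ → ℂ} {a w c : ℂ} (hf : AnalyticAt ℂ f a)
    (hd : deriv f a ≠ 0) (ha : a ≠ 0) (hc : 0 < c.re) (hw : w = deriv f a * (c * a)) :
    ∃ v : ℝ → ℂ, Tendsto v (𝓝[>] 0) (𝓝 a) ∧ (∀ᶠ t in 𝓝[>] 0, f (v t) = f a - t * w) ∧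
      ∀ᶠ t in 𝓝[>] 0, ‖v t‖ ^ 2 < ‖a‖ ^ 2 := by
  have hs : HasStrictDerivAt f (deriv f a) a := hf.hasStrictDerivAt
  set g := hs.localInverse f (deriv f a) a hd
  have hga : g (f a) = a := HasStrictFDerivAt.localInverse_apply_image ..
  have hp : HasDerivAt (fun t : ℝ => f a - t * w) (-w) 0 := by
    simpa using ((ofRealCLM.hasDerivAt (x := (0 : ℝ))).mul_const w).const_sub (f a)
  have hp0 : f a - ((0 : ℝ) : ℂ) * w = f a := by simp
  have hpt : Tendsto (fun t : ℝ => f a - t * w) (𝓝 0) (𝓝 (f a)) := by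
    simpa only [hp0] using hp.continuousAt.tendsto
  have hv : HasDerivAt (fun t : ℝ => g (f a - t * w)) (-(c * a)) 0 := by
    have h1 : HasDerivAt g (deriv f a)⁻¹ (f a - ((0 : ℝ) : ℂ) * w) := by
      rw [hp0]; exact (hs.to_localInverse hd).hasDerivAt
    refine (h1.comp (0 : ℝ) hp).congr_deriv ?_
    rw [hw]
    field_simp
  have hv0 : g (f a - ((0 : ℝ) : ℂ) * w) = a := by rw [hp0, hga]
  refine ⟨fun t => g (f a - t * w), ?_, ?_, ?_⟩
  · have := hv.continuousAt.tendsto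
    simp only [hv0] at this
    exact this.mono_left nhdsWithin_le_nhds
  · exact (hpt.eventually (hs.eventually_right_inverse hd)).filter_mono nhdsWithin_le_nhds
  · have hn := hv.norm_sq.eventually_lt_of_neg ?_
    · simpa only [hv0] using hn
    · have : 0 < normSq a := normSq_pos.2 ha
      rw [hv0, Complex.inner]
      have e : (starRingEnd ℂ a * -(c * a)).re = -(c.re * normSq a) := by
        simp [normSq_apply]; ring
      rw [mul_comm (-(c * a)), e]
      nlinarith [mul_pos hc this]

/-- On a compact set on which `f` is locally injective, the pairs of distinct points with the same
image form a compact set. -/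
lemma isCompact_setOf_ne_map_eq {X Y : Type*} [TopologicalSpace X] [T2Space X]
    [TopologicalSpace Y] [T2Space Y] {f : X → Y} {K : Set X} (hK : IsCompact K)
    (hf : ContinuousOn f K) (hinj : ∀ x ∈ K, ∃ U ∈ 𝓝 x, Set.InjOn f U) :
    IsCompact {p : X × X | p ∈ K ×ˢ K ∧ p.1 ≠ p.2 ∧ f p.1 = f p.2} := by
  have hKK := hK.prod hK
  refine hKK.of_isClosed_subset ?_ fun p hp => hp.1
  refine isClosed_iff_clusterPt.2 fun p hp => ?_
  have hpK : p ∈ K ×ˢ K :=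
    hKK.isClosed.closure_subset
      (mem_closure_iff_clusterPt.2 (hp.mono (principal_mono.2 fun q hq => hq.1)))
  have hne : (𝓝[{p : X × X | p ∈ K ×ˢ K ∧ p.1 ≠ p.2 ∧ f p.1 = f p.2}] p).NeBot := hp
  have hmem : ∀ᶠ q in 𝓝[{p : X × X | p ∈ K ×ˢ K ∧ p.1 ≠ p.2 ∧ f p.1 = f p.2}] p,
      q ∈ K ×ˢ K ∧ q.1 ≠ q.2 ∧ f q.1 = f q.2 := self_mem_nhdsWithin
  refine ⟨hpK, fun heq => ?_, ?_⟩
  · obtain ⟨U, hU, hUf⟩ := hinj p.1 hpK.1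
    have hUU : U ×ˢ U ∈ 𝓝 p := prod_mem_nhds hU (heq ▸ hU)
    obtain ⟨q, hq, hqU⟩ := (hmem.and (mem_nhdsWithin_of_mem_nhds hUU)).exists
    exact hq.2.1 (hUf hqU.1 hqU.2 hq.2.2)
  · have hfst : Tendsto Prod.fst (𝓝[{p : X × X | p ∈ K ×ˢ K ∧ p.1 ≠ p.2 ∧ f p.1 = f p.2}] p)
        (𝓝[K] p.1) := tendsto_nhdsWithin_iff.2
      ⟨continuous_fst.continuousAt.mono_left nhdsWithin_le_nhds, hmem.mono fun q hq => hq.1.1⟩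
    have hsnd : Tendsto Prod.snd (𝓝[{p : X × X | p ∈ K ×ˢ K ∧ p.1 ≠ p.2 ∧ f p.1 = f p.2}] p)
        (𝓝[K] p.2) := tendsto_nhdsWithin_iff.2
      ⟨continuous_snd.continuousAt.mono_left nhdsWithin_le_nhds, hmem.mono fun q hq => hq.1.2⟩
    exact tendsto_nhds_unique_of_eventuallyEq ((hf p.1 hpK.1).tendsto.comp hfst)
      ((hf p.2 hpK.2).tendsto.comp hsnd) (hmem.mono fun q hq => hq.2.2)

lemma HasStrictDerivAt.exists_injOn_nhds {f : ℂ → ℂ} {f' a : ℂ} (hf : HasStrictDerivAt f f' a)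
    (hf' : f' ≠ 0) : ∃ U ∈ 𝓝 a, Set.InjOn f U :=
  ⟨_, hf.eventually_left_inverse hf', fun x hx y hy hxy => by
    rw [← show _ = x from hx, ← show _ = y from hy, hxy]⟩

/-- **Sufficiency of Φ-likeness for univalence.**
If `f ∈ 𝒜` and there exist `Φ` analytic on `f(𝔻)` and `h` analytic on `𝔻` with
`Re h > 0` such that `z f'(z) = Φ(f(z)) h(z)` on `𝔻`, then `f` is univalent on `𝔻`. -/
theorem phi_like_implies_univalent (f Φ h : ℂ → ℂ)
    (hf : AnalyticOnNhd ℂ f (ball (0:ℂ) 1)) (hf0 : f 0 = 0) (hf1 : deriv f 0 = 1)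
    (hΦ : AnalyticOnNhd ℂ Φ (f '' ball (0:ℂ) 1))
    (hh : AnalyticOnNhd ℂ h (ball (0:ℂ) 1))
    (hre : ∀ z ∈ ball (0:ℂ) 1, 0 < (h z).re)
    (heq : ∀ z ∈ ball (0:ℂ) 1, z * deriv f z = Φ (f z) * h z) :
    Set.InjOn f (ball (0:ℂ) 1) := by
  have h0mem : (0 : ℂ) ∈ ball (0 : ℂ) 1 := mem_ball_self one_pos
  have hne : ∀ z ∈ ball (0 : ℂ) 1, h z ≠ 0 := fun z hz hz0 => by
    simpa [hz0] using hre z hz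
  have hΦ0 : Φ (f 0) = 0 := by
    simpa [hne 0 h0mem] using (heq 0 h0mem).symm
  have hΦne : ∀ z ∈ ball (0 : ℂ) 1, z ≠ 0 → Φ (f z) ≠ 0 := by
    intro a ha ha0 hzero
    have hloc : ∀ᶠ z in 𝓝 a, f z = f a := by
      refine eventually_eq_of_deriv_eq_comp_mul (k := fun z => h z / z) (hf a ha)
        (hΦ _ ⟨a, ha, rfl⟩) ((hh a ha).div analyticAt_id ha0) ?_ hzero
      filter_upwards [isOpen_ball.mem_nhds ha, isOpen_ne.mem_nhds ha0] with z hz hz0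
      have hz0 : z ≠ 0 := hz0
      rw [← mul_div_assoc, ← heq z hz, mul_div_cancel_left₀ _ hz0]
    have hconst : Set.EqOn f (fun _ => f a) (ball 0 1) :=
      hf.eqOn_of_preconnected_of_eventuallyEq analyticOnNhd_const
        (convex_ball 0 1).isPreconnected ha hloc
    have hd := (hconst.eventuallyEq_of_mem (isOpen_ball.mem_nhds h0mem)).deriv_eq
    simp [hf1] at hd
  have hd : ∀ z ∈ ball (0 : ℂ) 1, deriv f z ≠ 0 := by
    intro z hz hz0
    rcases eq_or_ne z 0 with rfl | hzne
    · simp [hf1] at hz0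
    · have := heq z hz
      rw [hz0, mul_zero] at this
      exact mul_ne_zero (hΦne z hz hzne) (hne z hz) this.symm
  have hlift : ∀ z ∈ ball (0 : ℂ) 1, z ≠ 0 → ∃ v : ℝ → ℂ, Tendsto v (𝓝[>] 0) (𝓝 z) ∧
      (∀ᶠ t in 𝓝[>] 0, f (v t) = f z - t * Φ (f z)) ∧
        ∀ᶠ t in 𝓝[>] 0, ‖v t‖ ^ 2 < ‖z‖ ^ 2 := fun z hz hz0 => by
    refine exists_lift_norm_decreasing (c := (h z)⁻¹) (hf z hz) (hd z hz) hz0 ?_ ?_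
    · rw [inv_re]
      exact div_pos (hre z hz) (normSq_pos.2 (hne z hz))
    · have := hne z hz
      field_simp
      linear_combination -heq z hz
  intro a₀ ha₀ b₀ hb₀ hab₀
  by_contra hne₀
  obtain ⟨R, hR, hR1⟩ : ∃ R, max ‖a₀‖ ‖b₀‖ ≤ R ∧ R < 1 :=
    ⟨_, le_rfl, max_lt (mem_ball_zero_iff.1 ha₀) (mem_ball_zero_iff.1 hb₀)⟩
  have hsub : closedBall (0 : ℂ) R ⊆ ball 0 1 := closedBall_subset_ball hR1
  have hcomp := isCompact_setOf_ne_map_eq (isCompact_closedBall (0 : ℂ) R)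
    (hf.continuousOn.mono hsub)
    fun z hz => ((hf z (hsub hz)).hasStrictDerivAt).exists_injOn_nhds (hd z (hsub hz))
  obtain ⟨⟨a, b⟩, ⟨⟨ha, hb⟩, hab, hfab⟩, hmin⟩ := hcomp.exists_isMinOn
    (f := fun p : ℂ × ℂ => ‖p.1‖ ^ 2 + ‖p.2‖ ^ 2)
    ⟨(a₀, b₀), ⟨mem_closedBall_zero_iff.2 ((le_max_left _ _).trans hR),
      mem_closedBall_zero_iff.2 ((le_max_right _ _).trans hR)⟩, hne₀, hab₀⟩ (by fun_prop)
  dsimp only at ha hb hab hfab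
  have ha0 : a ≠ 0 := by
    rintro rfl
    exact hΦne b (hsub hb) hab.symm (hfab ▸ hΦ0)
  have hb0 : b ≠ 0 := by
    rintro rfl
    exact hΦne a (hsub ha) hab (hfab ▸ hΦ0)
  obtain ⟨v, hva, hfv, hvlt⟩ := hlift a (hsub ha) ha0
  obtain ⟨u, hub, hfu, hult⟩ := hlift b (hsub hb) hb0
  have hvu : ∀ᶠ t in 𝓝[>] 0, v t ≠ u t := (hva.prodMk_nhds hub).eventually
    ((isOpen_ne_fun continuous_fst continuous_snd).mem_nhds hab)
  obtain ⟨t, hne, hfv, hvlt, hfu, hult⟩ :=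
    (hvu.and (hfv.and (hvlt.and (hfu.and hult)))).exists
  have hin : ∀ {x y : ℂ}, ‖x‖ ^ 2 < ‖y‖ ^ 2 → y ∈ closedBall (0 : ℂ) R →
      x ∈ closedBall (0 : ℂ) R := fun hxy hy => mem_closedBall_zero_iff.2
    ((lt_of_pow_lt_pow_left₀ 2 (norm_nonneg _) hxy).le.trans (mem_closedBall_zero_iff.1 hy))
  have hle : ‖a‖ ^ 2 + ‖b‖ ^ 2 ≤ ‖v t‖ ^ 2 + ‖u t‖ ^ 2 :=
    hmin (a := (v t, u t)) ⟨⟨hin hvlt ha, hin hult hb⟩, hne, by rw [hfv, hfu, hfab]⟩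
  linarith
end

section
/- Let f ∈ 𝒜 be univalent on 𝔻. Then there exist an analytic function Φ defined on f(𝔻) and an analytic function h on 𝔻 with Re h(z) > 0 for all z ∈ 𝔻, such that z·f'(z) = Φ(f(z))·h(z) for all z ∈ 𝔻 (i.e., f is Φ-like). -/
open Complex Metric

open scoped Topology

open Filter Set in
/-- The inverse of an injective open analytic map on an open set is analytic on the image, as soon
as the critical points of the map are isolated. -/
theorem analyticOnNhd_invFunOn_image {f : ℂ → ℂ} {U : Set ℂ} (hU : IsOpen U)
    (hf : AnalyticOnNhd ℂ f U) (hinj : InjOn f U)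
    (hopen : ∀ s ⊆ U, IsOpen s → IsOpen (f '' s))
    (hcrit : ∀ z ∈ U, ∀ᶠ x in 𝓝[≠] z, deriv f x ≠ 0) :
    AnalyticOnNhd ℂ (Function.invFunOn f U) (f '' U) := by
  set g := Function.invFunOn f U
  have hgf : ∀ z ∈ U, g (f z) = z := hinj.leftInvOn_invFunOn
  have hfg : ∀ w ∈ f '' U, f (g w) = w := fun w hw ↦ Function.invFunOn_eq hw
  have hmem : ∀ w ∈ f '' U, f '' U ∈ 𝓝 w := fun w hw ↦ (hopen U subset_rfl hU).mem_nhds hw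
  have hcont : ∀ w ∈ f '' U, ContinuousAt g w := by
    rintro _ ⟨z, hz, rfl⟩
    rw [ContinuousAt, hgf z hz, tendsto_def]
    intro N hN
    obtain ⟨V, hVN, hV, hzV⟩ := _root_.mem_nhds_iff.mp hN
    refine mem_of_superset ((hopen (V ∩ U) inter_subset_right (hV.inter hU)).mem_nhds
      ⟨z, ⟨hzV, hz⟩, rfl⟩) ?_
    rintro _ ⟨x, ⟨hxV, hxU⟩, rfl⟩
    simpa [hgf x hxU] using hVN hxV
  rintro _ ⟨z, hz, rfl⟩
  have hw : f z ∈ f '' U := mem_image_of_mem f hz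
  refine analyticAt_of_differentiable_on_punctured_nhds_of_continuousAt ?_ (hcont _ hw)
  have hpunct : Tendsto g (𝓝[≠] (f z)) (𝓝[≠] z) := by
    refine tendsto_nhdsWithin_iff.mpr ⟨?_, ?_⟩
    · simpa [ContinuousAt, hgf z hz] using (hcont _ hw).tendsto.mono_left nhdsWithin_le_nhds
    · filter_upwards [self_mem_nhdsWithin, nhdsWithin_le_nhds (hmem _ hw)] with y hy hyU hgy
      exact hy (by rw [mem_singleton_iff] at hgy ⊢; rw [← hfg y hyU, hgy])
  filter_upwards [hpunct.eventually (hcrit z hz), nhdsWithin_le_nhds (hmem _ hw)] with y hy hyU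
  exact (HasDerivAt.of_local_left_inverse (hcont y hyU)
    (hf _ (Function.invFunOn_mem hyU)).differentiableAt.hasDerivAt hy
    (eventually_of_mem (hmem y hyU) hfg)).differentiableAt

/-- **Necessity of Φ-likeness for univalence.**
If `f ∈ 𝒜` is univalent on `𝔻`, then there exist `Φ` analytic on `f(𝔻)` and `h`
analytic on `𝔻` with `Re h > 0` such that `z f'(z) = Φ(f(z)) h(z)` on `𝔻`. -/
theorem univalent_implies_phi_like (f : ℂ → ℂ)
    (hf : AnalyticOnNhd ℂ f (ball (0:ℂ) 1)) (hf0 : f 0 = 0) (hf1 : deriv f 0 = 1)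
    (hinj : Set.InjOn f (ball (0:ℂ) 1)) :
    ∃ Φ h : ℂ → ℂ,
      AnalyticOnNhd ℂ Φ (f '' ball (0:ℂ) 1) ∧
      AnalyticOnNhd ℂ h (ball (0:ℂ) 1) ∧
      (∀ z ∈ ball (0:ℂ) 1, 0 < (h z).re) ∧
      (∀ z ∈ ball (0:ℂ) 1, z * deriv f z = Φ (f z) * h z) := by
  have h0 : (0 : ℂ) ∈ ball (0 : ℂ) 1 := by simp
  have hconn : IsPreconnected (ball (0 : ℂ) 1) := (convex_ball 0 1).isPreconnected
  have hopen : ∀ s ⊆ ball (0 : ℂ) 1, IsOpen s → IsOpen (f '' s) := by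
    refine (hf.is_constant_or_isOpen hconn).resolve_left ?_
    rintro ⟨w, hw⟩
    have hhalf : (1 / 2 : ℂ) ∈ ball (0 : ℂ) 1 := by
      rw [mem_ball_zero_iff]; norm_num
    have := hinj h0 hhalf ((hw 0 h0).trans (hw _ hhalf).symm)
    norm_num at this
  have hcrit : ∀ z ∈ ball (0 : ℂ) 1, ∀ᶠ x in 𝓝[≠] z, deriv f x ≠ 0 := by
    intro z hz
    refine (hf.deriv z hz).eventually_eq_zero_or_eventually_ne_zero.resolve_left fun h ↦ ?_
    have := hf.deriv.eqOn_zero_of_preconnected_of_eventuallyEq_zero hconn hz h h0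
    simp [hf1] at this
  have hg := analyticOnNhd_invFunOn_image isOpen_ball hf hinj hopen hcrit
  refine ⟨fun w ↦ Function.invFunOn f (ball 0 1) w * deriv f (Function.invFunOn f (ball 0 1) w),
    fun _ ↦ 1, hg.mul (hf.deriv.comp hg fun w hw ↦ Function.invFunOn_mem hw),
    analyticOnNhd_const, by simp, fun z hz ↦ ?_⟩
  simp [hinj.leftInvOn_invFunOn hz]
end

section
/- Let λ ∈ (−π/2, π/2) and let g ∈ 𝒜 satisfy g(z) ≠ 0 for all z ∈ 𝔻 \ {0} and Re( e^{−iλ} · z g'(z)/g(z) ) > 0 for all z ∈ 𝔻 \ {0} (i.e., g is λ-spirallike). Then g is univalent on 𝔻. -/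
open Complex Metric

/-- **Noshiro–Warschawski theorem.** A holomorphic function on a convex set whose derivative takes
values in an open half plane bounded by a line through the origin is injective. -/
theorem Convex.injOn_of_re_mul_deriv_pos {s : Set ℂ} (hs : Convex ℝ s) {f f' : ℂ → ℂ} {c : ℂ}
    (hf : ∀ z ∈ s, HasDerivAt f (f' z) z) (hpos : ∀ z ∈ s, 0 < (c * f' z).re) :
    Set.InjOn f s := by
  intro a ha b hb hab
  by_contra hne
  have hba : b - a ≠ 0 := sub_ne_zero.mpr (Ne.symm hne)
  have hmem : ∀ t ∈ Set.Icc (0 : ℝ) 1, a + t * (b - a) ∈ s := fun t ht ↦ by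
    simpa using hs.add_smul_sub_mem ha hb ht
  let φ : ℝ → ℝ := fun t ↦ (c * (f (a + t * (b - a)) / (b - a))).re
  have hφ : ∀ t ∈ Set.Icc (0 : ℝ) 1, HasDerivAt φ (c * f' (a + t * (b - a))).re t := by
    intro t ht
    have hline : HasDerivAt (fun w : ℂ ↦ a + w * (b - a)) (b - a) (t : ℂ) := by
      simpa using ((hasDerivAt_id (t : ℂ)).mul_const (b - a)).const_add a
    have hcomp := (((hf _ (hmem t ht)).comp (t : ℂ) hline).div_const (b - a)).const_mul c
    rw [mul_div_cancel_right₀ _ hba] at hcomp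
    exact hcomp.real_of_complex
  have hmono : StrictMonoOn φ (Set.Icc 0 1) := by
    refine strictMonoOn_of_deriv_pos (convex_Icc 0 1)
      (fun t ht ↦ (hφ t ht).continuousAt.continuousWithinAt) fun t ht ↦ ?_
    have ht' := interior_subset ht
    rw [(hφ t ht').deriv]
    exact hpos _ (hmem t ht')
  have hlt := hmono (Set.left_mem_Icc.mpr zero_le_one) (Set.right_mem_Icc.mpr zero_le_one)
    zero_lt_one
  simp [φ, hab] at hlt

/-- A nonvanishing holomorphic function on a disk has a holomorphic logarithm. -/
theorem exists_differentiableOn_exp_eq_on_ball {h : ℂ → ℂ} {c : ℂ} {r : ℝ}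
    (hh : DifferentiableOn ℂ h (ball c r)) (hne : ∀ z ∈ ball c r, h z ≠ 0) :
    ∃ H : ℂ → ℂ, DifferentiableOn ℂ H (ball c r) ∧ ∀ z ∈ ball c r, exp (H z) = h z := by
  rcases le_or_gt r 0 with hr | hr
  · exact ⟨0, by simp [ball_eq_empty.mpr hr]⟩
  have hc : c ∈ ball c r := mem_ball_self hr
  obtain ⟨H, hHc, hH⟩ :=
    (((hh.deriv isOpen_ball).div hh hne).isExactOn_ball).with_val_at c (log (h c))
  refine ⟨H, fun z hz ↦ (hH z hz).differentiableAt.differentiableWithinAt, fun z hz ↦ ?_⟩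
  have hderiv : ∀ w ∈ ball c r, HasDerivAt (fun u ↦ exp (H u) / h u) 0 w := by
    intro w hw
    have hw0 := hne w hw
    refine ((hH w hw).cexp.div
      (hh.differentiableAt (isOpen_ball.mem_nhds hw)).hasDerivAt hw0).congr_deriv ?_
    simp only [Pi.div_apply]
    field_simp
    simp
  have hconst := isOpen_ball.is_const_of_deriv_eq_zero (convex_ball c r).isPreconnected
    (fun w hw ↦ (hderiv w hw).differentiableAt.differentiableWithinAt)
    (fun w hw ↦ (hderiv w hw).deriv) hz hc
  simp only [hHc, exp_log (hne c hc), div_self (hne c hc)] at hconst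
  exact (div_eq_one_iff_eq (hne z hz)).mp hconst

/-- **Spirallike functions are univalent.**
If `λ ∈ (−π/2, π/2)` and `g ∈ 𝒜` satisfies `g(z) ≠ 0` and
`Re(e^{−iλ} z g'(z)/g(z)) > 0` on `𝔻 \ {0}`, then `g` is univalent on `𝔻`. -/
theorem spirallike_implies_univalent (lam : ℝ)
    (hlam : lam ∈ Set.Ioo (-(Real.pi / 2)) (Real.pi / 2)) (g : ℂ → ℂ)
    (hg : AnalyticOnNhd ℂ g (ball (0:ℂ) 1)) (hg0 : g 0 = 0) (hg1 : deriv g 0 = 1)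
    (hne : ∀ z ∈ ball (0:ℂ) 1 \ {0}, g z ≠ 0)
    (hre : ∀ z ∈ ball (0:ℂ) 1 \ {0},
      0 < (Complex.exp (-(lam : ℂ) * Complex.I) * z * deriv g z / g z).re) :
    Set.InjOn g (ball (0:ℂ) 1) := by
  have h0 : (0 : ℂ) ∈ ball (0 : ℂ) 1 := mem_ball_self one_pos
  have hdiff : DifferentiableOn ℂ (dslope g 0) (ball 0 1) :=
    (differentiableOn_dslope (isOpen_ball.mem_nhds h0)).mpr hg.differentiableOn
  have hmul : ∀ z, z * dslope g 0 z = g z := fun z ↦ by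
    simpa [hg0] using sub_smul_dslope g 0 z
  have hslope : ∀ z ∈ ball (0 : ℂ) 1, dslope g 0 z ≠ 0 := by
    intro z hz
    rcases eq_or_ne z 0 with rfl | hz0
    · simp [dslope_same, hg1]
    · exact right_ne_zero_of_mul ((hmul z).trans_ne (hne z ⟨hz, hz0⟩))
  obtain ⟨H, hH, hexp⟩ := exists_differentiableOn_exp_eq_on_ball hdiff hslope
  let G : ℂ → ℂ := fun ζ ↦ H (exp ζ) + ζ
  have hmem : ∀ ζ ∈ {ζ : ℂ | ζ.re < 0}, exp ζ ∈ ball (0 : ℂ) 1 := fun ζ hζ ↦ by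
    simpa [norm_exp] using hζ
  have hexpG : ∀ ζ ∈ {ζ : ℂ | ζ.re < 0}, exp (G ζ) = g (exp ζ) := fun ζ hζ ↦ by
    rw [exp_add, hexp _ (hmem ζ hζ), mul_comm, hmul]
  have hopen : IsOpen {ζ : ℂ | ζ.re < 0} := isOpen_lt continuous_re continuous_const
  have hG : ∀ ζ ∈ {ζ : ℂ | ζ.re < 0},
      HasDerivAt G (exp ζ * deriv g (exp ζ) / g (exp ζ)) ζ := by
    intro ζ hζ
    have hGd : DifferentiableAt ℂ G ζ :=
      ((hH.differentiableAt (isOpen_ball.mem_nhds (hmem ζ hζ))).comp ζ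
        differentiable_exp.differentiableAt).add differentiableAt_id
    have hcomp : HasDerivAt (fun w ↦ g (exp w)) (deriv g (exp ζ) * exp ζ) ζ :=
      (hg _ (hmem ζ hζ)).differentiableAt.hasDerivAt.comp ζ (hasDerivAt_exp ζ)
    have heq : exp (G ζ) * deriv G ζ = deriv g (exp ζ) * exp ζ :=
      (hGd.hasDerivAt.cexp.congr_of_eventuallyEq
        (Filter.eventuallyEq_of_mem (hopen.mem_nhds hζ) fun w hw ↦ (hexpG w hw).symm)).unique hcomp
    rw [← hexpG ζ hζ, mul_comm, ← heq, mul_div_cancel_left₀ _ (exp_ne_zero _)]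
    exact hGd.hasDerivAt
  have hinj : Set.InjOn G {ζ : ℂ | ζ.re < 0} :=
    (convex_halfSpace_re_lt 0).injOn_of_re_mul_deriv_pos hG fun ζ hζ ↦ by
      simpa only [mul_div_assoc, mul_assoc] using hre _ ⟨hmem ζ hζ, exp_ne_zero ζ⟩
  have hzero : ∀ z ∈ ball (0 : ℂ) 1, g z = 0 → z = 0 := fun z hz hgz ↦
    by_contra fun hz0 ↦ hne z ⟨hz, hz0⟩ hgz
  intro z hz w hw hzw
  rcases eq_or_ne z 0 with rfl | hz0
  · exact (hzero w hw (hzw ▸ hg0)).symm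
  rcases eq_or_ne w 0 with rfl | hw0
  · exact hzero z hz (hzw.trans hg0)
  have hlog : ∀ u ∈ ball (0 : ℂ) 1, u ≠ 0 → (log u).re < 0 := fun u hu hu0 ↦ by
    rw [log_re]
    exact Real.log_neg (norm_pos_iff.mpr hu0) (mem_ball_zero_iff.mp hu)
  have hlz := hlog z hz hz0
  have hlw := hlog w hw hw0
  obtain ⟨n, hn⟩ := exp_eq_exp_iff_exists_int.mp <|
    show exp (G (log z)) = exp (G (log w)) by
      rw [hexpG _ hlz, hexpG _ hlw, exp_log hz0, exp_log hw0, hzw]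
  have hperiod : exp (log w + n * (2 * Real.pi * I)) = w := by
    rw [exp_add, exp_int_mul_two_pi_mul_I, mul_one, exp_log hw0]
  have hshift : G (log z) = G (log w + n * (2 * Real.pi * I)) := by
    rw [hn]
    simp only [G, hperiod, exp_log hw0, add_assoc]
  have hlogs := hinj hlz (show (log w + n * (2 * Real.pi * I)).re < 0 by simpa using hlw) hshift
  rw [← exp_log hz0, hlogs, hperiod]
end

section
/- Let s = α + iβ with α > 0 and β ∈ ℝ. Let p be analytic on 𝔻 with p(0) = 0, p'(0) = 1, univalent on 𝔻, and starlike, i.e., p(z) ≠ 0 and Re( z p'(z)/p(z) ) > 0 for all z ∈ 𝔻 \ {0}. Let f ∈ 𝒜 be univalent on 𝔻. Then there exists an analytic function Ψ on f(𝔻) with Ψ(0) ≠ 0 such that Re[ f'(z) · (f(z)/z)^{s−1} · (p(z)/z)^{−α} · Ψ(f(z)) ] > 0 for all z ∈ 𝔻, where (f(z)/z)^{s−1} and (p(z)/z)^{α} denote the analytic branches of these powers on 𝔻 taking the value 1 at z = 0. (Necessity direction of the generalized Bazilevič condition.) -/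
open Complex Metric

/-- An analytic function which is injective near a point has nonzero derivative there. -/
theorem AnalyticAt.deriv_ne_zero_of_injOn {f : ℂ → ℂ} {z₀ : ℂ} {U : Set ℂ}
    (hf : AnalyticAt ℂ f z₀) (hU : U ∈ nhds z₀) (hinj : Set.InjOn f U) : deriv f z₀ ≠ 0 := by
  have hF : AnalyticAt ℂ (fun z ↦ f z - f z₀) z₀ := hf.sub analyticAt_const
  have htop : analyticOrderAt (fun z ↦ f z - f z₀) z₀ ≠ ⊤ := by
    intro h
    obtain ⟨z, ⟨hz, hzU⟩, hne⟩ := (((analyticOrderAt_eq_top.1 h).and hU).filter_mono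
      (nhdsWithin_le_nhds (s := {z₀}ᶜ))).and self_mem_nhdsWithin |>.exists
    exact hne (hinj hzU (mem_of_mem_nhds hU) (sub_eq_zero.1 hz))
  obtain ⟨g, hg, hg0, hfg⟩ := hF.analyticOrderAt_ne_top.1 htop
  set n := analyticOrderNatAt (fun z ↦ f z - f z₀) z₀
  have hn : n ≠ 0 := by
    intro h
    have := hfg.self_of_nhds
    simp only [h, sub_self, pow_zero, one_smul] at this
    exact hg0 this.symm
  -- a local analytic `n`-th root `h` of `f - f z₀`
  obtain ⟨c, hc⟩ := IsAlgClosed.exists_pow_nat_eq (g z₀) (Nat.pos_of_ne_zero hn)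
  have hc0 : c ≠ 0 := by
    rintro rfl
    exact hg0 (by rw [← hc, zero_pow hn])
  have hq : AnalyticAt ℂ (fun z ↦ c * (g z / g z₀) ^ ((n : ℂ)⁻¹)) z₀ :=
    analyticAt_const.mul ((hg.div analyticAt_const hg0).cpow analyticAt_const
      (by simp [div_self hg0]))
  set h : ℂ → ℂ := fun z ↦ (z - z₀) * (c * (g z / g z₀) ^ ((n : ℂ)⁻¹)) with h_def
  have hh : AnalyticAt ℂ h z₀ := (analyticAt_id.sub analyticAt_const).mul hq
  have hpow : ∀ᶠ z in nhds z₀, f z - f z₀ = h z ^ n := by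
    filter_upwards [hfg] with z hz
    rw [hz, h_def]
    simp only [mul_pow, hc, Complex.cpow_nat_inv_pow _ hn, smul_eq_mul]
    field_simp
  have hderiv : HasDerivAt h c z₀ := by
    have := ((hasDerivAt_id z₀).sub_const z₀).mul hq.differentiableAt.hasDerivAt
    simpa [div_self hg0] using! this
  have hmap : Filter.map h (nhds z₀) = nhds 0 := by
    have := hh.hasStrictDerivAt.map_nhds_eq (by rwa [hderiv.deriv])
    rwa [show h z₀ = 0 by simp [h_def]] at this
  -- a primitive `n`-th root of unity must be trivial
  obtain hn1 | hn1 := eq_or_ne n 1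
  · have hd : HasDerivAt f c z₀ := by
      refine (hderiv.add_const (f z₀)).congr_of_eventuallyEq ?_
      filter_upwards [hpow] with z hz
      rw [hn1, pow_one] at hz
      exact sub_eq_iff_eq_add.1 hz
    rwa [hd.deriv]
  · exfalso
    have hω := Complex.isPrimitiveRoot_exp n hn
    set ω := Complex.exp (2 * Real.pi * Complex.I / n)
    have hV : h '' {z | z ∈ U ∧ f z - f z₀ = h z ^ n} ∈ nhds 0 := by
      rw [← hmap]
      exact Filter.image_mem_map (Filter.inter_mem hU hpow)
    have hV' : ∀ᶠ w in nhds (0 : ℂ), ω * w ∈ h '' {z | z ∈ U ∧ f z - f z₀ = h z ^ n} := by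
      have : Filter.Tendsto (fun w : ℂ ↦ ω * w) (nhds 0) (nhds 0) := by
        simpa using (continuous_const_mul ω).tendsto 0
      exact this hV
    obtain ⟨w, ⟨⟨z₁, ⟨hz₁, he₁⟩, hw₁⟩, ⟨z₂, ⟨hz₂, he₂⟩, hw₂⟩⟩, hw0⟩ :=
      ((Filter.Eventually.and hV hV').filter_mono
        (nhdsWithin_le_nhds (s := {0}ᶜ))).and self_mem_nhdsWithin |>.exists
    have heq : f z₁ = f z₂ := by
      rw [hw₁] at he₁
      rw [hw₂, mul_pow, hω.pow_eq_one, one_mul, ← he₁] at he₂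
      exact (sub_left_inj.1 he₂).symm
    rw [hinj hz₁ hz₂ heq, hw₂] at hw₁
    refine hω.ne_one (by omega) ?_
    exact mul_right_cancel₀ hw0 (by rw [hw₁, one_mul])

/-- If `f` is analytic and injective on an open set `U`, every analytic function on `U` factors
through `f` by an analytic function on `f '' U`. -/
theorem AnalyticOnNhd.exists_analyticOnNhd_image_comp_eq {f F : ℂ → ℂ} {U : Set ℂ} (hU : IsOpen U)
    (hf : AnalyticOnNhd ℂ f U) (hinj : Set.InjOn f U) (hF : AnalyticOnNhd ℂ F U) :
    ∃ G : ℂ → ℂ, AnalyticOnNhd ℂ G (f '' U) ∧ ∀ z ∈ U, G (f z) = F z := by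
  have hG : ∀ z ∈ U, F (Function.invFunOn f U (f z)) = F z := fun z hz ↦ by
    rw [hinj.leftInvOn_invFunOn hz]
  refine ⟨F ∘ Function.invFunOn f U, ?_, hG⟩
  rintro _ ⟨z, hz, rfl⟩
  have hzU := hU.mem_nhds hz
  rw [← analyticAt_comp_iff_of_deriv_ne_zero (hf z hz)
    ((hf z hz).deriv_ne_zero_of_injOn hzU hinj)]
  refine (hF z hz).congr ?_
  filter_upwards [hzU] with w hw using (hG w hw).symm

/-- **Generalized Bazilevič condition (necessity).**
Let `s = α + iβ`, `α > 0`, `p` starlike univalent in `𝒜`, and `f ∈ 𝒜` univalent on `𝔻`.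
The analytic branches `(f(z)/z)^{s−1}` and `(p(z)/z)^{−α}` taking the value `1` at `0`
are written as `exp((s−1)·Lf z)` and `exp(−α·Lp z)` for analytic logarithms `Lf`, `Lp`
with `Lf 0 = Lp 0 = 0`.  Then there exists `Ψ` analytic on `f(𝔻)` with `Ψ(0) ≠ 0` such
that `Re[f'(z) (f(z)/z)^{s−1} (p(z)/z)^{−α} Ψ(f(z))] > 0` on `𝔻`. -/
theorem generalized_bazilevic_necessity (α β : ℝ) (hα : 0 < α) (s : ℂ)
    (hs : s = (α : ℂ) + (β : ℂ) * Complex.I) (p f Lf Lp : ℂ → ℂ)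
    (hp : AnalyticOnNhd ℂ p (ball (0:ℂ) 1)) (hp0 : p 0 = 0) (hp1 : deriv p 0 = 1)
    (hpinj : Set.InjOn p (ball (0:ℂ) 1))
    (hpne : ∀ z ∈ ball (0:ℂ) 1 \ {0}, p z ≠ 0)
    (hpstar : ∀ z ∈ ball (0:ℂ) 1 \ {0}, 0 < (z * deriv p z / p z).re)
    (hf : AnalyticOnNhd ℂ f (ball (0:ℂ) 1)) (hf0 : f 0 = 0) (hf1 : deriv f 0 = 1)
    (hfinj : Set.InjOn f (ball (0:ℂ) 1))
    (hLf : AnalyticOnNhd ℂ Lf (ball (0:ℂ) 1)) (hLf0 : Lf 0 = 0)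
    (hLfe : ∀ z ∈ ball (0:ℂ) 1, z ≠ 0 → Complex.exp (Lf z) = f z / z)
    (hLp : AnalyticOnNhd ℂ Lp (ball (0:ℂ) 1)) (hLp0 : Lp 0 = 0)
    (hLpe : ∀ z ∈ ball (0:ℂ) 1, z ≠ 0 → Complex.exp (Lp z) = p z / z) :
    ∃ Ψ : ℂ → ℂ, AnalyticOnNhd ℂ Ψ (f '' ball (0:ℂ) 1) ∧ Ψ 0 ≠ 0 ∧
      ∀ z ∈ ball (0:ℂ) 1,
        0 < (deriv f z * Complex.exp ((s - 1) * Lf z) *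
          Complex.exp (-(α : ℂ) * Lp z) * Ψ (f z)).re := by
  have hQ0 : ∀ z ∈ ball (0:ℂ) 1, deriv f z * Complex.exp ((s - 1) * Lf z) *
      Complex.exp (-(α : ℂ) * Lp z) ≠ 0 := fun z hz ↦
    mul_ne_zero (mul_ne_zero ((hf z hz).deriv_ne_zero_of_injOn (isOpen_ball.mem_nhds hz) hfinj)
      (Complex.exp_ne_zero _)) (Complex.exp_ne_zero _)
  have hQ : AnalyticOnNhd ℂ (fun z ↦ (deriv f z * Complex.exp ((s - 1) * Lf z) *
      Complex.exp (-(α : ℂ) * Lp z))⁻¹) (ball (0:ℂ) 1) := fun z hz ↦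
    (((hf.deriv z hz).mul (analyticAt_const.mul (hLf z hz)).cexp).mul
      (analyticAt_const.mul (hLp z hz)).cexp).inv (hQ0 z hz)
  obtain ⟨Ψ, hΨ, hΨf⟩ := hf.exists_analyticOnNhd_image_comp_eq isOpen_ball hfinj hQ
  have h0 : (0:ℂ) ∈ ball (0:ℂ) 1 := mem_ball_self one_pos
  refine ⟨Ψ, hΨ, ?_, fun z hz ↦ ?_⟩
  · have := hΨf 0 h0
    rw [hf0] at this
    rw [this]
    exact inv_ne_zero (hQ0 0 h0)
  · rw [hΨf z hz, mul_inv_cancel₀ (hQ0 z hz)]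
    simp
end
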